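/- Let b_n = (1/n)·∑_{k=1}^{n} k·t_k·3^{n−k}·C(2n, n−k). Then b_n ~ (√3·Γ(3/4)·12^n)/(4π·n^{3/4}) as n → ∞; that is, lim_{n→∞} b_n · 4π·n^{3/4} / (√3·Γ(3/4)·12^n) = 1. (This is the asymptotic number of well-labelled unicycles with n edges carrying a distinguished oriented edge on the cycle.) -/

import Mathlib

open Filter

/-- The central trinomial coefficient `t_k`: the number of sequences
`(s_1, …, s_k) ∈ {-1,0,1}^k` with `s_1 + ⋯ + s_k = 0`. -/
def trinom (k : ℕ) : ℕ :=
  (Finset.univ.filter (fun s : Fin k → Fin 3 => (∑ i, ((s i : ℤ) - 1)) = 0)).card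

/-- `b_n = (1/n) ∑_{k=1}^n k t_k 3^{n-k} C(2n, n-k)`, the number of
well-labelled unicycles with `n` edges and a distinguished oriented edge on the cycle. -/
noncomputable def bSeq (n : ℕ) : ℝ :=
  (1 / (n : ℝ)) * ∑ k ∈ Finset.Icc 1 n,
    (k : ℝ) * (trinom k : ℝ) * (3 : ℝ) ^ (n - k) * (Nat.choose (2 * n) (n - k) : ℝ)

theorem integral_exp_int_mul_I (m : ℤ) :
    ∫ θ in (-Real.pi)..Real.pi, Complex.exp ((m : ℂ) * Complex.I * (θ : ℂ)) =
      if m = 0 then 2 * (Real.pi : ℂ) else 0 := by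
  split_ifs with h
  · subst h
    simp
    ring
  · have hm : (m : ℂ) * Complex.I ≠ 0 := by simp [h]
    rw [integral_exp_mul_complex hm, div_eq_zero_iff]
    left
    rw [sub_eq_zero, Complex.exp_eq_exp_iff_exists_int]
    exact ⟨m, by push_cast; ring⟩

theorem one_add_two_mul_cos_pow (k : ℕ) (θ : ℝ) :
    (((1 + 2 * Real.cos θ) ^ k : ℝ) : ℂ) =
      ∑ s : Fin k → Fin 3,
        Complex.exp (((∑ i, ((s i : ℤ) - 1) : ℤ) : ℂ) * Complex.I * (θ : ℂ)) := by
  have h1 : ((1 + 2 * Real.cos θ : ℝ) : ℂ) =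
      ∑ j : Fin 3, Complex.exp ((((j : ℤ) - 1 : ℤ) : ℂ) * Complex.I * (θ : ℂ)) := by
    rw [Fin.sum_univ_three]
    push_cast
    rw [Complex.two_cos]
    simp
    norm_num
    ring_nf
  have h2 := Finset.prod_univ_sum (fun _ : Fin k => (Finset.univ : Finset (Fin 3)))
    (fun _ j => Complex.exp ((((j : ℤ) - 1 : ℤ) : ℂ) * Complex.I * (θ : ℂ)))
  rw [Complex.ofReal_pow, h1]
  simp only [Finset.prod_const, Finset.card_univ, Fintype.card_fin, Fintype.piFinset_univ] at h2
  rw [h2]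
  refine Finset.sum_congr rfl fun s _ => ?_
  rw [← Complex.exp_sum]
  congr 1
  push_cast
  rw [Finset.sum_mul, Finset.sum_mul]

theorem integral_one_add_two_mul_cos_pow (k : ℕ) :
    ∫ θ in (-Real.pi)..Real.pi, (1 + 2 * Real.cos θ) ^ k = 2 * Real.pi * trinom k := by
  apply Complex.ofReal_injective
  rw [← intervalIntegral.integral_ofReal]
  simp_rw [one_add_two_mul_cos_pow]
  rw [intervalIntegral.integral_finsetSum]
  · simp_rw [integral_exp_int_mul_I]
    rw [← Finset.sum_filter, Finset.sum_const, trinom]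
    push_cast
    rw [nsmul_eq_mul]
    ring
  · intro s _
    apply Continuous.intervalIntegrable
    fun_prop

theorem abs_one_add_two_mul_cos_div_three_le {θ : ℝ} (hθ : |θ| ≤ Real.pi) :
    |(1 + 2 * Real.cos θ) / 3| ≤ Real.exp (-(θ ^ 2 / Real.pi ^ 2)) := by
  have hpi := Real.pi_pos
  have hq : θ ^ 2 / Real.pi ^ 2 ≤ 1 := by
    rw [div_le_one (by positivity)]
    exact sq_le_sq' (abs_le.mp hθ).1 (abs_le.mp hθ).2
  rw [abs_le]
  constructor
  · have h1 : Real.exp (-1) ≤ Real.exp (-(θ ^ 2 / Real.pi ^ 2)) :=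
      Real.exp_le_exp.mpr (by linarith)
    have h2 : (1 / 3 : ℝ) ≤ Real.exp (-1) := by
      rw [Real.exp_neg, one_div]
      exact inv_anti₀ (Real.exp_pos 1) (by linarith [Real.exp_one_lt_d9])
    linarith [Real.neg_one_le_cos θ]
  · have h1 := Real.cos_le_one_sub_mul_cos_sq hθ
    have h2 := Real.add_one_le_exp (-(θ ^ 2 / Real.pi ^ 2))
    have h3 : 2 / Real.pi ^ 2 * θ ^ 2 = 2 * (θ ^ 2 / Real.pi ^ 2) := by ring
    have h4 : 0 ≤ θ ^ 2 / Real.pi ^ 2 := by positivity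
    rw [h3] at h1
    linarith

theorem tendsto_one_add_two_mul_cos_div_three_pow (u : ℝ) :
    Tendsto (fun k : ℕ => ((1 + 2 * Real.cos (u / √k)) / 3) ^ k) atTop
      (nhds (Real.exp (-(1 / 3) * u ^ 2))) := by
  have h : Tendsto (fun k : ℕ => (k : ℝ) * (2 / 3 * (Real.cos (u / √k) - 1))) atTop
      (nhds (-(1 / 3) * u ^ 2)) := by
    have hx : Tendsto (fun k : ℕ => u / √(k : ℝ)) atTop (nhds 0) :=
      tendsto_const_nhds.div_atTop
        (Real.tendsto_sqrt_atTop.comp tendsto_natCast_atTop_atTop)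
    have herr : Tendsto (fun k : ℕ => u ^ 2 * (u / √(k : ℝ)) ^ 2) atTop (nhds 0) := by
      simpa using (hx.pow 2).const_mul (u ^ 2)
    rw [tendsto_iff_norm_sub_tendsto_zero]
    refine squeeze_zero' (Eventually.of_forall fun _ => norm_nonneg _) ?_ herr
    have h1 : ∀ᶠ k : ℕ in atTop, |u / √(k : ℝ)| < 1 := by
      have := hx.abs
      rw [abs_zero] at this
      exact this.eventually (gt_mem_nhds one_pos)
    filter_upwards [h1, eventually_gt_atTop 0] with k hk hk0
    have hkpos : (0 : ℝ) < k := by exact_mod_cast hk0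
    have hb := Real.cos_bound hk.le
    set x := u / √(k : ℝ) with hxdef
    have hkx : (k : ℝ) * x ^ 2 = u ^ 2 := by
      rw [hxdef, div_pow, Real.sq_sqrt hkpos.le]
      field_simp
    have e : (k : ℝ) * (2 / 3 * (Real.cos x - 1)) - -(1 / 3) * u ^ 2 =
        2 / 3 * k * (Real.cos x - (1 - x ^ 2 / 2)) := by
      rw [← hkx]
      ring
    rw [e, Real.norm_eq_abs, abs_mul, abs_of_pos (by positivity : (0 : ℝ) < 2 / 3 * k)]
    have h4 : |x| ^ 4 = x ^ 2 * x ^ 2 := by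
      rw [← sq_abs x]
      ring
    rw [h4] at hb
    calc 2 / 3 * k * |Real.cos x - (1 - x ^ 2 / 2)|
        ≤ 2 / 3 * k * (x ^ 2 * x ^ 2 * (5 / 96)) := by gcongr
      _ = 10 / 288 * ((k * x ^ 2) * x ^ 2) := by ring
      _ ≤ u ^ 2 * x ^ 2 := by
        rw [hkx]
        nlinarith [mul_nonneg (sq_nonneg u) (sq_nonneg x)]
  refine (Real.tendsto_one_add_pow_exp_of_tendsto h).congr fun k => ?_
  congr 1
  ring

theorem tendsto_sqrt_mul_trinom_div_three_pow :
    Tendsto (fun k : ℕ => √k * (trinom k : ℝ) / 3 ^ k) atTop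
      (nhds (√3 / (2 * √Real.pi))) := by
  have hpi := Real.pi_pos
  let F : ℕ → ℝ → ℝ := fun k => (Set.Ioc (-Real.pi * √k) (Real.pi * √k)).indicator
    fun u => ((1 + 2 * Real.cos (u / √k)) / 3) ^ k
  have hF : ∀ᶠ k : ℕ in atTop,
      1 / (2 * Real.pi) * ∫ u, F k u = √k * (trinom k : ℝ) / 3 ^ k := by
    filter_upwards [eventually_gt_atTop 0] with k hk
    have hkpos : (0 : ℝ) < k := by exact_mod_cast hk
    have hs : 0 < √(k : ℝ) := Real.sqrt_pos.mpr hkpos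
    have hc : ∫ u in (-Real.pi * √k)..(Real.pi * √k), ((1 + 2 * Real.cos (u / √k)) / 3) ^ k =
        √k * (2 * Real.pi * trinom k / 3 ^ k) := by
      rw [intervalIntegral.integral_comp_div (fun θ => ((1 + 2 * Real.cos θ) / 3) ^ k) hs.ne',
        mul_div_cancel_right₀ _ hs.ne', mul_div_cancel_right₀ _ hs.ne', smul_eq_mul]
      simp_rw [div_pow]
      rw [intervalIntegral.integral_div, integral_one_add_two_mul_cos_pow]
    rw [MeasureTheory.integral_indicator measurableSet_Ioc,
      ← intervalIntegral.integral_of_le (by nlinarith), hc]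
    field_simp
  have hlim : Tendsto (fun k => ∫ u, F k u) atTop
      (nhds (∫ u : ℝ, Real.exp (-(1 / 3) * u ^ 2))) := by
    refine MeasureTheory.tendsto_integral_of_dominated_convergence
      (fun u => Real.exp (-(1 / Real.pi ^ 2) * u ^ 2)) (fun k => ?_)
      (integrable_exp_neg_mul_sq (by positivity)) (fun k => ?_) ?_
    · refine (Measurable.indicator ?_ measurableSet_Ioc).aestronglyMeasurable
      fun_prop
    · refine Eventually.of_forall fun u => ?_
      by_cases hu : u ∈ Set.Ioc (-Real.pi * √k) (Real.pi * √k)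
      · simp only [F, Set.indicator_of_mem hu]
        have hs : 0 < √(k : ℝ) := by
          by_contra hs
          have : √(k : ℝ) = 0 := le_antisymm (not_lt.mp hs) (Real.sqrt_nonneg _)
          rw [this] at hu
          simp at hu
        have hkpos := Real.sqrt_pos.mp hs
        have hle : |u / √k| ≤ Real.pi := by
          rw [abs_div, abs_of_pos hs, div_le_iff₀ hs, abs_le]
          exact ⟨by linarith [hu.1], hu.2⟩
        rw [norm_pow, Real.norm_eq_abs]
        calc |(1 + 2 * Real.cos (u / √k)) / 3| ^ k
            ≤ Real.exp (-((u / √k) ^ 2 / Real.pi ^ 2)) ^ k := by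
              gcongr
              exact abs_one_add_two_mul_cos_div_three_le hle
          _ = Real.exp (-(1 / Real.pi ^ 2) * u ^ 2) := by
              rw [← Real.exp_nat_mul, div_pow, Real.sq_sqrt hkpos.le]
              congr 1
              field_simp
      · simp only [F, Set.indicator_of_notMem hu, norm_zero]
        positivity
    · refine Eventually.of_forall fun u => ?_
      refine (tendsto_one_add_two_mul_cos_div_three_pow u).congr' ?_
      have ht : Tendsto (fun k : ℕ => Real.pi * √(k : ℝ)) atTop atTop :=
        (Real.tendsto_sqrt_atTop.comp tendsto_natCast_atTop_atTop).const_mul_atTop hpi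
      filter_upwards [ht.eventually_gt_atTop |u|] with k hk
      rw [abs_lt] at hk
      have hu : u ∈ Set.Ioc (-Real.pi * √k) (Real.pi * √k) := ⟨by linarith [hk.1], hk.2.le⟩
      simp only [F, Set.indicator_of_mem hu]
  rw [integral_gaussian] at hlim
  have hval : 1 / (2 * Real.pi) * √(Real.pi / (1 / 3)) = √3 / (2 * √Real.pi) := by
    rw [div_div_eq_mul_div, div_one, Real.sqrt_mul hpi.le]
    have h := Real.mul_self_sqrt hpi.le
    have hs := Real.sqrt_pos.mpr hpi
    field_simp
    linarith
  rw [← hval]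
  exact (hlim.const_mul _).congr' hF

theorem tendsto_sqrt_mul_centralBinom_div_four_pow :
    Tendsto (fun n : ℕ => √n * (n.centralBinom : ℝ) / 4 ^ n) atTop
      (nhds (1 / √Real.pi)) := by
  have hpi := Real.sqrt_pos.mpr Real.pi_pos
  have h2 : Tendsto (fun n : ℕ => Stirling.stirlingSeq (2 * n)) atTop (nhds √Real.pi) :=
    Stirling.tendsto_stirlingSeq_sqrt_pi.comp
      (tendsto_id.const_mul_atTop' two_pos)
  have h := h2.div (Stirling.tendsto_stirlingSeq_sqrt_pi.pow 2) (by positivity)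
  have e : √Real.pi / √Real.pi ^ 2 = 1 / √Real.pi := by field_simp
  rw [e] at h
  refine h.congr' ?_
  filter_upwards [eventually_gt_atTop 0] with n hn
  have hnpos : (0 : ℝ) < n := by exact_mod_cast hn
  have hs : √(n : ℝ) ^ 2 = n := Real.sq_sqrt hnpos.le
  have hs' : 0 < √(n : ℝ) := Real.sqrt_pos.mpr hnpos
  have hcb : (n.centralBinom : ℝ) = ((2 * n).factorial : ℝ) / (n.factorial : ℝ) ^ 2 := by
    rw [Nat.centralBinom_eq_two_mul_choose, Nat.cast_choose ℝ (by omega)]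
    have : 2 * n - n = n := by omega
    rw [this, sq]
  have hfac : (0 : ℝ) < n.factorial := by positivity
  have h4 : √(2 * ((2 * n : ℕ) : ℝ)) = 2 * √n := by
    rw [show (2 * ((2 * n : ℕ) : ℝ)) = 2 ^ 2 * n by push_cast; ring,
      Real.sqrt_mul (by norm_num), Real.sqrt_sq (by norm_num)]
  have hp : (((2 * n : ℕ) : ℝ) / Real.exp 1) ^ (2 * n) =
      4 ^ n * ((n : ℝ) / Real.exp 1) ^ (2 * n) := by
    rw [show ((2 * n : ℕ) : ℝ) / Real.exp 1 = 2 * (n / Real.exp 1) by push_cast; ring,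
      mul_pow, pow_mul 2 2 n]
    norm_num
  simp only [Pi.div_apply]
  rw [Stirling.stirlingSeq, Stirling.stirlingSeq, hcb, h4, hp]
  have hq : (0 : ℝ) < (n : ℝ) / Real.exp 1 := by positivity
  generalize (n : ℝ) / Real.exp 1 = q at hq ⊢
  rw [div_pow, mul_pow, Real.sq_sqrt (by positivity), ← pow_mul, mul_comm n 2]
  field_simp
  rw [hs]

theorem choose_sub_succ_div_centralBinom {n k : ℕ} (hk : k < n) :
    ((2 * n).choose (n - (k + 1)) : ℝ) / n.centralBinom =
      ((2 * n).choose (n - k) : ℝ) / n.centralBinom * (((n : ℝ) - k) / (n + k + 1)) := by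
  have h := Nat.choose_succ_right_eq (2 * n) (n - (k + 1))
  have e1 : n - (k + 1) + 1 = n - k := by omega
  have e2 : 2 * n - (n - (k + 1)) = n + k + 1 := by omega
  rw [e1, e2] at h
  have h' : ((2 * n).choose (n - k) : ℝ) * ((n : ℝ) - k) =
      ((2 * n).choose (n - (k + 1)) : ℝ) * (n + k + 1) := by
    rw [← Nat.cast_sub hk.le]
    exact_mod_cast h
  have hpos : (0 : ℝ) < n + k + 1 := by positivity
  rw [div_mul_div_comm, h', mul_div_mul_right _ _ hpos.ne']

theorem choose_sub_div_centralBinom_le {n K k : ℕ} (hkK : k ≤ K) (hKn : K ≤ n) :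
    ((2 * n).choose (n - k) : ℝ) / n.centralBinom ≤
      Real.exp (-((k : ℝ) ^ 2 / (n + K))) := by
  induction k with
  | zero =>
    have := n.centralBinom_pos
    simp [← Nat.centralBinom_eq_two_mul_choose, div_self_le_one]
  | succ k ih =>
    have hk : (k : ℝ) + 1 ≤ K := by exact_mod_cast hkK
    have hK : (K : ℝ) ≤ n := by exact_mod_cast hKn
    have hk0 : (0 : ℝ) ≤ k := k.cast_nonneg
    have hstep : ((n : ℝ) - k) / (n + k + 1) ≤ Real.exp (-((2 * k + 1) / (n + K))) :=
      calc ((n : ℝ) - k) / (n + k + 1) = -((2 * k + 1) / (n + k + 1)) + 1 := by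
            field_simp
            ring
        _ ≤ -((2 * k + 1) / (n + K)) + 1 := by
            have : (2 * (k : ℝ) + 1) / (n + K) ≤ (2 * k + 1) / (n + k + 1) := by
              apply div_le_div_of_nonneg_left <;> linarith
            linarith
        _ ≤ _ := Real.add_one_le_exp _
    rw [choose_sub_succ_div_centralBinom (by omega)]
    calc _ ≤ Real.exp (-((k : ℝ) ^ 2 / (n + K))) * Real.exp (-((2 * k + 1) / (n + K))) := by
          gcongr
          · apply div_nonneg <;> linarith
          · exact ih (by omega)
      _ = _ := by
          rw [← Real.exp_add]
          congr 1
          push_cast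
          ring

theorem le_choose_sub_div_centralBinom {n K k : ℕ} (hkK : k ≤ K) (hKn : K ≤ n) :
    Real.exp (-((k : ℝ) ^ 2 / (n - K + 1))) ≤
      ((2 * n).choose (n - k) : ℝ) / n.centralBinom := by
  induction k with
  | zero =>
    have : (n.centralBinom : ℝ) ≠ 0 := by exact_mod_cast n.centralBinom_ne_zero
    simp [← Nat.centralBinom_eq_two_mul_choose, div_self this]
  | succ k ih =>
    have hk : (k : ℝ) + 1 ≤ K := by exact_mod_cast hkK
    have hK : (K : ℝ) ≤ n := by exact_mod_cast hKn
    have hk0 : (0 : ℝ) ≤ k := k.cast_nonneg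
    have hnk : (0 : ℝ) < n - k := by linarith
    have hstep : Real.exp (-((2 * k + 1) / (n - K + 1))) ≤ ((n : ℝ) - k) / (n + k + 1) := by
      rw [Real.exp_neg, ← inv_div ((n : ℝ) + k + 1)]
      apply inv_anti₀ (by positivity)
      calc ((n : ℝ) + k + 1) / (n - k) = (2 * k + 1) / (n - k) + 1 := by
            field_simp
            ring
        _ ≤ (2 * k + 1) / (n - K + 1) + 1 := by
            gcongr ?_ / ?_ + 1 <;> linarith
        _ ≤ _ := Real.add_one_le_exp _
    rw [choose_sub_succ_div_centralBinom (by omega)]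
    calc _ = Real.exp (-((k : ℝ) ^ 2 / (n - K + 1))) *
          Real.exp (-((2 * k + 1) / (n - K + 1))) := by
          rw [← Real.exp_add]
          congr 1
          push_cast
          ring
      _ ≤ _ := by
          gcongr
          exact ih (by omega)

theorem tendsto_ceil_mul_sqrt_div_sqrt {x : ℝ} (hx : 0 ≤ x) :
    Tendsto (fun n : ℕ => (⌈x * √n⌉₊ : ℝ) / √n) atTop (nhds x) :=
  (tendsto_nat_ceil_mul_div_atTop hx).comp
    (Real.tendsto_sqrt_atTop.comp tendsto_natCast_atTop_atTop)

theorem tendsto_choose_sub_ceil_div_centralBinom {x : ℝ} (hx : 0 ≤ x) :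
    Tendsto (fun n : ℕ => ((2 * n).choose (n - ⌈x * √n⌉₊) : ℝ) / n.centralBinom) atTop
      (nhds (Real.exp (-x ^ 2))) := by
  have hy := tendsto_ceil_mul_sqrt_div_sqrt hx
  have hs : Tendsto (fun n : ℕ => √(n : ℝ)) atTop atTop :=
    Real.tendsto_sqrt_atTop.comp tendsto_natCast_atTop_atTop
  have hinv : Tendsto (fun n : ℕ => (√(n : ℝ))⁻¹) atTop (nhds 0) := hs.inv_tendsto_atTop
  have hz : Tendsto (fun n : ℕ => (⌈x * √n⌉₊ : ℝ) / √n * (√(n : ℝ))⁻¹) atTop (nhds 0) := by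
    simpa using hy.mul hinv
  have hle : ∀ᶠ n : ℕ in atTop, ⌈x * √n⌉₊ ≤ n := by
    filter_upwards [hz.eventually (gt_mem_nhds one_pos), eventually_gt_atTop 0] with n h hn
    have hnpos : (0 : ℝ) < n := by exact_mod_cast hn
    rw [← div_eq_mul_inv, div_div, Real.mul_self_sqrt hnpos.le, div_lt_one hnpos] at h
    exact_mod_cast h.le
  have hup : Tendsto (fun n : ℕ => Real.exp (-(((⌈x * √n⌉₊ : ℝ) / √n) ^ 2 /
      (1 + (⌈x * √n⌉₊ : ℝ) / √n * (√(n : ℝ))⁻¹)))) atTop (nhds (Real.exp (-x ^ 2))) := by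
    have := (hy.pow 2).div (hz.const_add 1) (by norm_num)
    rw [add_zero, div_one] at this
    exact (Real.continuous_exp.tendsto _).comp this.neg
  have hlo : Tendsto (fun n : ℕ => Real.exp (-(((⌈x * √n⌉₊ : ℝ) / √n) ^ 2 /
      (1 - (⌈x * √n⌉₊ : ℝ) / √n * (√(n : ℝ))⁻¹ + (√(n : ℝ))⁻¹ * (√(n : ℝ))⁻¹)))) atTop
      (nhds (Real.exp (-x ^ 2))) := by
    have := (hy.pow 2).div ((hz.const_sub 1).add (hinv.mul hinv)) (by norm_num)
    rw [mul_zero, add_zero, sub_zero, div_one] at this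
    exact (Real.continuous_exp.tendsto _).comp this.neg
  refine tendsto_of_tendsto_of_tendsto_of_le_of_le' hlo hup ?_ ?_
  · filter_upwards [hle, eventually_gt_atTop 0] with n h hn
    have hnpos : (0 : ℝ) < n := by exact_mod_cast hn
    have hsn := Real.sqrt_pos.mpr hnpos
    refine le_trans (le_of_eq ?_) (le_choose_sub_div_centralBinom le_rfl h)
    have hK : (⌈x * √n⌉₊ : ℝ) ≤ n := by exact_mod_cast h
    generalize (⌈x * √n⌉₊ : ℝ) = K at hK ⊢
    have hd : 1 - K / √n * (√(n : ℝ))⁻¹ + (√(n : ℝ))⁻¹ * (√(n : ℝ))⁻¹ = (n - K + 1) / n := by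
      rw [← mul_inv, ← div_eq_mul_inv, div_div, Real.mul_self_sqrt hnpos.le]
      field_simp
    rw [hd, div_pow, Real.sq_sqrt hnpos.le, div_div_div_cancel_right₀ hnpos.ne']
  · filter_upwards [hle, eventually_gt_atTop 0] with n h hn
    have hnpos : (0 : ℝ) < n := by exact_mod_cast hn
    refine (choose_sub_div_centralBinom_le le_rfl h).trans (le_of_eq ?_)
    generalize (⌈x * √n⌉₊ : ℝ) = K
    have hd : 1 + K / √n * (√(n : ℝ))⁻¹ = (n + K) / n := by
      rw [← div_eq_mul_inv, div_div, Real.mul_self_sqrt hnpos.le]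
      field_simp
    rw [hd, div_pow, Real.sq_sqrt hnpos.le, div_div_div_cancel_right₀ hnpos.ne']

theorem integral_comp_natCeil (g : ℕ → ℝ) (n : ℕ) :
    ∫ x in (0 : ℝ)..n, g ⌈x⌉₊ = ∑ k ∈ Finset.Icc 1 n, g k := by
  have hceil : ∀ k : ℕ, Set.EqOn (fun x : ℝ => g ⌈x⌉₊) (fun _ => g (k + 1))
      (Set.uIoc (k : ℝ) (k + 1 : ℕ)) := by
    intro k x hx
    rw [Set.uIoc_of_le (by push_cast; linarith)] at hx
    have : ⌈x⌉₊ = k + 1 := by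
      rw [Nat.ceil_eq_iff (by omega)]
      exact ⟨by simpa using hx.1, by exact_mod_cast hx.2⟩
    simp only [this]
  have h := intervalIntegral.sum_integral_adjacent_intervals
    (f := fun x : ℝ => g ⌈x⌉₊) (μ := MeasureTheory.volume) (a := fun k : ℕ => (k : ℝ)) (n := n)
    (fun k _ => (intervalIntegrable_const (c := g (k + 1))).congr (hceil k).symm)
  rw [Nat.cast_zero] at h
  have hshift : ∑ k ∈ Finset.Icc 1 n, g k = ∑ k ∈ Finset.range n, g (k + 1) := by
    rw [Finset.range_eq_Ico, Finset.sum_Ico_add' g 0 n 1, zero_add]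
    rfl
  rw [← h, hshift]
  refine Finset.sum_congr rfl fun k _ => ?_
  rw [intervalIntegral.integral_congr_ae (Eventually.of_forall (hceil k))]
  simp

theorem integral_indicator_sqrt_mul_exp_neg_sq (c : ℝ) :
    ∫ x : ℝ, (Set.Ioi 0).indicator (fun x => √x * c * Real.exp (-x ^ 2)) x =
      c * (1 / 2 * Real.Gamma (3 / 4)) := by
  rw [MeasureTheory.integral_indicator measurableSet_Ioi]
  have h := integral_rpow_mul_exp_neg_rpow (p := 2) (q := 1 / 2) two_pos (by norm_num)
  rw [show ((1 / 2 + 1) / 2 : ℝ) = 3 / 4 by norm_num] at h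
  rw [← h, ← MeasureTheory.integral_const_mul]
  refine MeasureTheory.setIntegral_congr_fun measurableSet_Ioi fun x _ => ?_
  simp only [Real.rpow_two, Real.sqrt_eq_rpow]
  ring

theorem tendsto_sum_sqrt_mul_choose_sub_div_centralBinom {a : ℕ → ℝ} {c : ℝ}
    (ha : Tendsto a atTop (nhds c)) :
    Tendsto (fun n : ℕ => (√n)⁻¹ * ∑ k ∈ Finset.Icc 1 n,
        √(k / √n) * a k * (((2 * n).choose (n - k) : ℝ) / n.centralBinom)) atTop
      (nhds (c * (1 / 2 * Real.Gamma (3 / 4)))) := by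
  have hsqrt : Tendsto (fun n : ℕ => √(n : ℝ)) atTop atTop :=
    Real.tendsto_sqrt_atTop.comp tendsto_natCast_atTop_atTop
  obtain ⟨M, hM⟩ := ha.norm.bddAbove_range
  have hM' : ∀ k, |a k| ≤ M := fun k => hM ⟨k, rfl⟩
  have hM0 : 0 ≤ M := (abs_nonneg _).trans (hM' 0)
  let h : ℕ → ℕ → ℝ := fun n k =>
    √(k / √n) * a k * (((2 * n).choose (n - k) : ℝ) / n.centralBinom)
  let F : ℕ → ℝ → ℝ := fun n =>
    (Set.Ioc 0 √(n : ℝ)).indicator fun x => h n ⌈x * √n⌉₊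
  have hF : ∀ᶠ n : ℕ in atTop, ∫ x, F n x = (√n)⁻¹ * ∑ k ∈ Finset.Icc 1 n, h n k := by
    filter_upwards [eventually_gt_atTop 0] with n hn
    have hnpos : (0 : ℝ) < n := by exact_mod_cast hn
    have hs : 0 < √(n : ℝ) := Real.sqrt_pos.mpr hnpos
    rw [MeasureTheory.integral_indicator measurableSet_Ioc,
      ← intervalIntegral.integral_of_le hs.le,
      intervalIntegral.integral_comp_mul_right (fun x => h n ⌈x⌉₊) hs.ne',
      zero_mul, Real.mul_self_sqrt hnpos.le, integral_comp_natCeil, smul_eq_mul]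
  refine Tendsto.congr' hF ?_
  rw [← integral_indicator_sqrt_mul_exp_neg_sq]
  refine MeasureTheory.tendsto_integral_of_dominated_convergence
    (fun x => M * (|x| * Real.exp (-(1 / 2) * x ^ 2) + 2 * Real.exp (-(1 / 2) * x ^ 2)))
    (fun n => ?_) ?_ (fun n => Eventually.of_forall fun x => ?_)
    (Eventually.of_forall fun x => ?_)
  · refine (Measurable.indicator ?_ measurableSet_Ioc).aestronglyMeasurable
    exact (measurable_from_top (f := h n)).comp
      (Nat.measurable_ceil.comp (measurable_id.mul_const _))
  · have h1 := (integrable_mul_exp_neg_mul_sq (b := 1 / 2) (by norm_num)).norm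
    simp only [norm_mul, Real.norm_eq_abs, Real.abs_exp] at h1
    exact (h1.add ((integrable_exp_neg_mul_sq (by norm_num)).const_mul 2)).const_mul M
  · by_cases hx : x ∈ Set.Ioc 0 √(n : ℝ)
    · simp only [F, Set.indicator_of_mem hx]
      have hs : 0 < √(n : ℝ) := hx.1.trans_le hx.2
      have hnpos : (0 : ℝ) < n := Real.sqrt_pos.mp hs
      have hs1 : 1 ≤ √(n : ℝ) := by
        rw [Real.one_le_sqrt]
        exact_mod_cast hnpos
      have hKn : ⌈x * √n⌉₊ ≤ n := by
        rw [Nat.ceil_le]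
        calc x * √n ≤ √n * √n := by gcongr; exact hx.2
          _ = n := Real.mul_self_sqrt hnpos.le
      have hK1 : x * √n ≤ (⌈x * √n⌉₊ : ℝ) := Nat.le_ceil _
      have hK2 : (⌈x * √n⌉₊ : ℝ) < x * √n + 1 := Nat.ceil_lt_add_one (by have := hx.1; positivity)
      have hr := choose_sub_div_centralBinom_le hKn le_rfl
      simp only [h]
      have haK := hM' ⌈x * √n⌉₊
      generalize ⌈x * √n⌉₊ = K at *
      have hx0 := hx.1
      have hw : √(K / √n) ≤ x + 2 := by
        rw [Real.sqrt_le_left (by linarith), div_le_iff₀ hs]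
        nlinarith [mul_pos hx0 hs, mul_pos (mul_pos hx0 hx0) hs]
      have hr' : ((2 * n).choose (n - K) : ℝ) / n.centralBinom ≤
          Real.exp (-(1 / 2) * x ^ 2) := by
        refine hr.trans (Real.exp_le_exp.mpr ?_)
        have : x ^ 2 / 2 ≤ (K : ℝ) ^ 2 / (n + n) := by
          rw [div_le_div_iff₀ two_pos (by positivity)]
          have hsq : (x * √n) ^ 2 ≤ (K : ℝ) ^ 2 := by gcongr
          rw [mul_pow, Real.sq_sqrt hnpos.le] at hsq
          linarith
        linarith
      rw [norm_mul, norm_mul, Real.norm_of_nonneg (Real.sqrt_nonneg _), Real.norm_eq_abs,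
        Real.norm_of_nonneg (by positivity), abs_of_pos hx0]
      calc _ ≤ (x + 2) * M * Real.exp (-(1 / 2) * x ^ 2) := by gcongr
        _ = _ := by ring
    · simp only [F, Set.indicator_of_notMem hx, norm_zero]
      positivity
  · by_cases hx : 0 < x
    · rw [Set.indicator_of_mem (show x ∈ Set.Ioi 0 from hx)]
      have hceil : Tendsto (fun n : ℕ => ⌈x * √n⌉₊) atTop atTop :=
        tendsto_nat_ceil_atTop.comp (hsqrt.const_mul_atTop hx)
      have hlim := (((Real.continuous_sqrt.tendsto _).comp
        (tendsto_ceil_mul_sqrt_div_sqrt hx.le)).mul (ha.comp hceil)).mul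
        (tendsto_choose_sub_ceil_div_centralBinom hx.le)
      refine hlim.congr' ?_
      filter_upwards [hsqrt.eventually_ge_atTop x] with n hn
      simp only [F, Set.indicator_of_mem (show x ∈ Set.Ioc 0 √(n : ℝ) from ⟨hx, hn⟩), h,
        Function.comp_apply]
    · rw [Set.indicator_of_notMem (show x ∉ Set.Ioi 0 from hx)]
      refine tendsto_const_nhds.congr fun n => ?_
      simp only [F, Set.indicator_of_notMem (show x ∉ Set.Ioc 0 √(n : ℝ) from fun h => hx h.1)]

theorem bSeq_mul_rpow_div_twelve_pow {n : ℕ} (hn : 0 < n) :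
    bSeq n * (n : ℝ) ^ ((3 : ℝ) / 4) / 12 ^ n =
      √n * (n.centralBinom : ℝ) / 4 ^ n * ((√n)⁻¹ * ∑ k ∈ Finset.Icc 1 n,
        √(k / √n) * (√k * (trinom k : ℝ) / 3 ^ k) *
          (((2 * n).choose (n - k) : ℝ) / n.centralBinom)) := by
  have hnpos : (0 : ℝ) < n := by exact_mod_cast hn
  have hs : 0 < √(n : ℝ) := Real.sqrt_pos.mpr hnpos
  have hss : 0 < √√(n : ℝ) := Real.sqrt_pos.mpr hs
  have hcb : (0 : ℝ) < n.centralBinom := by exact_mod_cast n.centralBinom_pos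
  have hp : (n : ℝ) ^ ((3 : ℝ) / 4) = n / √√n := by
    rw [eq_div_iff hss.ne', Real.sqrt_eq_rpow, Real.sqrt_eq_rpow, ← Real.rpow_mul hnpos.le,
      ← Real.rpow_add hnpos]
    norm_num
  rw [hp, bSeq, show (12 : ℝ) = 3 * 4 by norm_num, mul_pow]
  simp only [Finset.mul_sum, Finset.sum_mul, Finset.sum_div]
  refine Finset.sum_congr rfl fun k hk => ?_
  have hkn := (Finset.mem_Icc.mp hk).2
  have hk2 : √(k : ℝ) * √k = k := Real.mul_self_sqrt k.cast_nonneg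
  have h3 : (3 : ℝ) ^ n = 3 ^ (n - k) * 3 ^ k := by rw [← pow_add, Nat.sub_add_cancel hkn]
  rw [Real.sqrt_div k.cast_nonneg, h3]
  nth_rewrite 1 [← hk2]
  field_simp

/-- Asymptotics `b_n ∼ √3 Γ(3/4) 12^n / (4π n^{3/4})` as `n → ∞`. -/
theorem bSeq_asymptotics :
    Tendsto (fun n : ℕ =>
        bSeq n * (4 * Real.pi * (n : ℝ) ^ ((3 : ℝ) / 4)) /
          (Real.sqrt 3 * Real.Gamma (3 / 4) * (12 : ℝ) ^ n))
      atTop (nhds 1) := by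
  have hpi := Real.pi_pos
  have hG : 0 < Real.Gamma (3 / 4) := Real.Gamma_pos_of_pos (by norm_num)
  have h := (tendsto_sqrt_mul_centralBinom_div_four_pow.mul
    (tendsto_sum_sqrt_mul_choose_sub_div_centralBinom
      tendsto_sqrt_mul_trinom_div_three_pow)).mul_const
    (4 * Real.pi / (√3 * Real.Gamma (3 / 4)))
  have hval : 1 / √Real.pi * (√3 / (2 * √Real.pi) * (1 / 2 * Real.Gamma (3 / 4))) *
      (4 * Real.pi / (√3 * Real.Gamma (3 / 4))) = 1 := by
    have hs := Real.sqrt_pos.mpr hpi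
    field_simp
    rw [Real.sq_sqrt hpi.le]
    ring
  rw [hval] at h
  refine h.congr' ?_
  filter_upwards [eventually_gt_atTop 0] with n hn
  rw [← bSeq_mul_rpow_div_twelve_pow hn]
  field_simp
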